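/- (Level lemma for necessitation in M_{S4}.) For every k ≥ 0 and every formula α: if every valuation w ∈ L_k assigns a designated value (1 or 2) to α, then every valuation v ∈ L_{k+1} satisfies v(α) = 2 and hence v(□α) = 2. -/

import Mathlib

/-- Modal formulas. -/
inductive MForm : Type where
  | atom : ℕ → MForm
  | bot : MForm
  | top : MForm
  | neg : MForm → MForm
  | box : MForm → MForm
  | imp : MForm → MForm → MForm
  | conj : MForm → MForm → MForm
  | disj : MForm → MForm → MForm
deriving DecidableEq

/-- Truth values of `M_{S4}`: `v0 = 0`, `v1 = 1`, `v2 = 2`; designated are `v1, v2`. -/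
inductive MVal : Type where
  | v0 : MVal
  | v1 : MVal
  | v2 : MVal
deriving DecidableEq

/-- Multifunction for negation. -/
def MNeg : MVal → Set MVal
  | MVal.v2 => {MVal.v0}
  | MVal.v1 => {MVal.v0}
  | MVal.v0 => {MVal.v1, MVal.v2}

/-- Multifunction for box. -/
def MBox : MVal → Set MVal
  | MVal.v2 => {MVal.v2}
  | MVal.v1 => {MVal.v0}
  | MVal.v0 => {MVal.v0}

/-- Multifunction for implication. -/
def MImp : MVal → MVal → Set MVal
  | MVal.v2, MVal.v2 => {MVal.v2}
  | MVal.v2, MVal.v1 => {MVal.v1}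
  | MVal.v2, MVal.v0 => {MVal.v0}
  | MVal.v1, MVal.v2 => {MVal.v2}
  | MVal.v1, MVal.v1 => {MVal.v1, MVal.v2}
  | MVal.v1, MVal.v0 => {MVal.v0}
  | MVal.v0, MVal.v2 => {MVal.v2}
  | MVal.v0, MVal.v1 => {MVal.v1, MVal.v2}
  | MVal.v0, MVal.v0 => {MVal.v1, MVal.v2}

/-- Conjunction is the minimum. -/
def MMin : MVal → MVal → MVal
  | MVal.v0, _ => MVal.v0
  | _, MVal.v0 => MVal.v0
  | MVal.v1, _ => MVal.v1
  | _, MVal.v1 => MVal.v1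
  | MVal.v2, MVal.v2 => MVal.v2

/-- Multifunction for disjunction. -/
def MDisj : MVal → MVal → Set MVal
  | MVal.v2, _ => {MVal.v2}
  | _, MVal.v2 => {MVal.v2}
  | MVal.v0, MVal.v0 => {MVal.v0}
  | _, _ => {MVal.v1, MVal.v2}

/-- `v ∈ Val(M_{S4})`. -/
def MIsVal (v : MForm → MVal) : Prop :=
  v MForm.bot = MVal.v0 ∧ v MForm.top = MVal.v2 ∧
  (∀ a, v (MForm.neg a) ∈ MNeg (v a)) ∧
  (∀ a, v (MForm.box a) ∈ MBox (v a)) ∧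
  (∀ a b, v (MForm.imp a b) ∈ MImp (v a) (v b)) ∧
  (∀ a b, v (MForm.conj a b) = MMin (v a) (v b)) ∧
  (∀ a b, v (MForm.disj a b) ∈ MDisj (v a) (v b))

/-- The levels `L_k` for `M_{S4}`. -/
def MLev : ℕ → Set (MForm → MVal)
  | 0 => {v | MIsVal v}
  | k + 1 => {v | v ∈ MLev k ∧
      ∀ a, v a = MVal.v1 →
        ∃ w ∈ MLev k, w a = MVal.v0 ∧ ∀ b, v b = MVal.v2 → w b = MVal.v2}

/-- `L^{S4} = ⋂_k L_k`. -/
def MLimit : Set (MForm → MVal) := {v | ∀ k, v ∈ MLev k}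

theorem isVal_of_mem_MLev {v : MForm → MVal} : ∀ {k : ℕ}, v ∈ MLev k → MIsVal v
  | 0, hv => hv
  | _ + 1, hv => isVal_of_mem_MLev hv.1

theorem MIsVal.box_eq {v : MForm → MVal} (hv : MIsVal v) {a : MForm} (ha : v a = MVal.v2) :
    v (MForm.box a) = MVal.v2 := by
  have hbox := hv.2.2.2.1 a
  rw [ha] at hbox
  exact hbox

theorem level_lemma_necessitation (k : ℕ) (a : MForm)
    (h : ∀ w ∈ MLev k, w a ≠ MVal.v0) :
    ∀ v ∈ MLev (k + 1), v a = MVal.v2 ∧ v (MForm.box a) = MVal.v2 := by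
  intro v hv
  have ha : v a = MVal.v2 := by
    cases hva : v a with
    | v0 => exact absurd hva (h v hv.1)
    | v1 =>
      obtain ⟨w, hw, hwa, -⟩ := hv.2 a hva
      exact absurd hwa (h w hw)
    | v2 => rfl
  exact ⟨ha, (isVal_of_mem_MLev hv).box_eq ha⟩
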